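/- arXiv:1502.07656 — 3 statements merged into one kernel-verified Lean document; each statement's English description precedes it below -/
import Mathlib

section
/- The (m+n)² matrices u_{jk} := ⟦c_j^+, c_k^−⟧ for 1 ≤ j, k ≤ m+n (a commutator unless both j > m and k > m, in which case an anticommutator) are linearly independent over ℂ, and their complex linear span is closed under the super bracket: for all j, k, j', k' ∈ {1,…,m+n}, the matrix ⟦u_{jk}, u_{j'k'}⟧, taken with parities ⟨j⟩+⟨k⟩ mod 2 and ⟨j'⟩+⟨k'⟩ mod 2, is a complex linear combination of the matrices u_{j''k''}. (This span is the subalgebra u(m|n) of osp(2m+1|2n).) -/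
/- Setup: the generators `c_j^±` of osp(2m+1|2n) realized as matrices, and the
subalgebra u(m|n) spanned by the brackets `⟦c_j^+, c_k^-⟧`. -/

noncomputable section

/-- `matE m n i j` is the `N×N` complex matrix (`N = 2m+2n+1`) with a `1` in
(1-based) position `(i,j)` and zeros elsewhere. -/
def matE (m n : ℕ) (i j : ℕ) : Matrix (Fin (2*m+2*n+1)) (Fin (2*m+2*n+1)) ℂ :=
  Matrix.of fun a b => if a.val + 1 = i ∧ b.val + 1 = j then 1 else 0

/-- The generators `c_j^s` (1-based index `j ∈ {1,…,m+n}`, sign `s ∈ {1,-1}`). -/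
def cgen (m n : ℕ) (j : ℕ) (s : ℤ) : Matrix (Fin (2*m+2*n+1)) (Fin (2*m+2*n+1)) ℂ :=
  if j ≤ m then
    if s = 1 then
      (Real.sqrt 2 : ℂ) • (matE m n j (2*m+1) - matE m n (2*m+1) (j+m))
    else
      (Real.sqrt 2 : ℂ) • (matE m n (2*m+1) j - matE m n (j+m) (2*m+1))
  else
    if s = 1 then
      (Real.sqrt 2 : ℂ) • (matE m n (2*m+1) (2*m+1+n+(j-m)) + matE m n (2*m+1+(j-m)) (2*m+1))
    else
      (Real.sqrt 2 : ℂ) • (matE m n (2*m+1) (2*m+1+(j-m)) - matE m n (2*m+1+n+(j-m)) (2*m+1))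

/-- The parity `⟨j⟩` of the generator `c_j^±`: `0` for `j ≤ m`, `1` for `j > m`. -/
def par (m : ℕ) (j : ℕ) : ℕ := if j ≤ m then 0 else 1

/-- The super bracket `⟦A,B⟧ = AB - (-1)^{ab} BA` of matrices `A`, `B` carrying
parities `a`, `b` (in `{0,1}`). -/
def sbr (m n : ℕ) (a b : ℕ) (A B : Matrix (Fin (2*m+2*n+1)) (Fin (2*m+2*n+1)) ℂ) :
    Matrix (Fin (2*m+2*n+1)) (Fin (2*m+2*n+1)) ℂ :=
  A * B - ((-1 : ℂ)^(a*b)) • (B * A)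

/-- `u_{jk} = ⟦c_j^+, c_k^-⟧` (a commutator unless both `j > m` and `k > m`,
in which case an anticommutator). -/
def ugen (m n : ℕ) (j k : ℕ) : Matrix (Fin (2*m+2*n+1)) (Fin (2*m+2*n+1)) ℂ :=
  sbr m n (par m j) (par m k) (cgen m n j 1) (cgen m n k (-1))

set_option linter.all false

theorem matE_mul (m n a b c d : ℕ) (h1 : 1 ≤ b) (h2 : b ≤ 2*m+2*n+1) :
    matE m n a b * matE m n c d = if b = c then matE m n a d else 0 := by
  ext x y
  rw [Matrix.mul_apply]
  rw [Finset.sum_eq_single (⟨b-1, by omega⟩ : Fin (2*m+2*n+1))]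
  · have : b - 1 + 1 = b := by omega
    by_cases hbc : b = c
    · subst hbc
      simp only [matE, Matrix.of_apply, this]
      by_cases hx : x.val + 1 = a <;> by_cases hy : y.val + 1 = d <;> simp [hx, hy]
    · simp [matE, this, hbc]
  · intro z _ hz
    have : ¬ (z.val + 1 = b) := by
      intro h; apply hz; ext; simp; omega
    simp [matE, this]
  · simp

/-- positions of the first block -/
def posP (m : ℕ) (j : ℕ) : ℕ := if j ≤ m then j else 2*m+1+(j-m)

/-- positions of the second block -/
def posQ (m n : ℕ) (j : ℕ) : ℕ := if j ≤ m then j+m else 2*m+1+n+(j-m)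

/-- the sign in front of the second block -/
def sgnU (m j k : ℕ) : ℂ := (-1)^(par m j * par m k + par m j)

theorem cgen_plus (m n j : ℕ) : cgen m n j 1 = (Real.sqrt 2 : ℂ) •
    (matE m n (posP m j) (2*m+1) - ((-1 : ℂ)^(par m j)) • matE m n (2*m+1) (posQ m n j)) := by
  unfold cgen posP posQ par
  split_ifs <;> simp_all [add_comm]

theorem cgen_minus (m n j : ℕ) : cgen m n j (-1) = (Real.sqrt 2 : ℂ) •
    (matE m n (2*m+1) (posP m j) - matE m n (posQ m n j) (2*m+1)) := by
  unfold cgen posP posQ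
  split_ifs <;> simp_all

theorem posP_bd {m n j : ℕ} (h : j ∈ Finset.Icc 1 (m+n)) :
    1 ≤ posP m j ∧ posP m j ≤ 2*m+2*n+1 ∧ posP m j ≠ 2*m+1 := by
  simp only [Finset.mem_Icc] at h
  unfold posP; split_ifs <;> omega

theorem posQ_bd {m n j : ℕ} (h : j ∈ Finset.Icc 1 (m+n)) :
    1 ≤ posQ m n j ∧ posQ m n j ≤ 2*m+2*n+1 ∧ posQ m n j ≠ 2*m+1 := by
  simp only [Finset.mem_Icc] at h
  unfold posQ; split_ifs <;> omega

theorem posP_inj {m n j k : ℕ} (h : j ∈ Finset.Icc 1 (m+n)) (h' : k ∈ Finset.Icc 1 (m+n)) :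
    posP m j = posP m k ↔ j = k := by
  simp only [Finset.mem_Icc] at h h'
  unfold posP; split_ifs <;> omega

theorem posQ_inj {m n j k : ℕ} (h : j ∈ Finset.Icc 1 (m+n)) (h' : k ∈ Finset.Icc 1 (m+n)) :
    posQ m n j = posQ m n k ↔ j = k := by
  simp only [Finset.mem_Icc] at h h'
  unfold posQ; split_ifs <;> omega

theorem posPQ {m n j k : ℕ} (h : j ∈ Finset.Icc 1 (m+n)) (h' : k ∈ Finset.Icc 1 (m+n)) :
    posP m j ≠ posQ m n k := by
  simp only [Finset.mem_Icc] at h h'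
  unfold posP posQ; split_ifs <;> omega

theorem ugen_eq {m n j k : ℕ} (hj : j ∈ Finset.Icc 1 (m+n)) (hk : k ∈ Finset.Icc 1 (m+n)) :
    ugen m n j k = (2 : ℂ) • (matE m n (posP m j) (posP m k)
      - sgnU m j k • matE m n (posQ m n k) (posQ m n j)) := by
  obtain ⟨a1, a2, a3⟩ := posP_bd hj
  obtain ⟨b1, b2, b3⟩ := posP_bd hk
  obtain ⟨c1, c2, c3⟩ := posQ_bd hj
  obtain ⟨d1, d2, d3⟩ := posQ_bd hk
  have hs : (Real.sqrt 2 : ℂ) * (Real.sqrt 2 : ℂ) = 2 := by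
    rw [← Complex.ofReal_mul, Real.mul_self_sqrt (by norm_num)]; norm_num
  have e1 : 1 ≤ 2*m+1 := by omega
  have e2 : 2*m+1 ≤ 2*m+2*n+1 := by omega
  have hkj : k = j ↔ j = k := eq_comm
  unfold ugen sbr sgnU
  rw [cgen_plus, cgen_minus, smul_mul_smul_comm, smul_mul_smul_comm, hs]
  simp only [sub_mul, mul_sub, smul_mul_assoc, mul_smul_comm,
    matE_mul _ _ _ _ _ _ e1 e2, matE_mul _ _ _ _ _ _ b1 b2, matE_mul _ _ _ _ _ _ c1 c2,
    matE_mul _ _ _ _ _ _ a1 a2, matE_mul _ _ _ _ _ _ d1 d2,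
    posP_inj hk hj, posQ_inj hj hk, a3, b3, c3, d3, a3.symm, b3.symm, c3.symm, d3.symm,
    if_true, if_false, smul_zero, sub_zero, zero_sub, hkj]
  by_cases h : j = k
  · subst h
    unfold par
    split_ifs <;> simp <;> module
  · simp only [h, if_false]
    unfold par
    split_ifs <;> simp <;> module

theorem sbr_ugen {m n j k j' k' : ℕ} (hj : j ∈ Finset.Icc 1 (m+n)) (hk : k ∈ Finset.Icc 1 (m+n))
    (hj' : j' ∈ Finset.Icc 1 (m+n)) (hk' : k' ∈ Finset.Icc 1 (m+n)) :
    sbr m n ((par m j + par m k) % 2) ((par m j' + par m k') % 2)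
          (ugen m n j k) (ugen m n j' k') =
    (if k = j' then (2:ℂ) else 0) • ugen m n j k' -
    ((-1 : ℂ)^(((par m j + par m k) % 2) * ((par m j' + par m k') % 2)) *
      (if j = k' then (2:ℂ) else 0)) • ugen m n j' k := by
  obtain ⟨b1, b2, -⟩ := posP_bd hk
  obtain ⟨c1, c2, -⟩ := posQ_bd hj
  obtain ⟨b1', b2', -⟩ := posP_bd hk'
  obtain ⟨c1', c2', -⟩ := posQ_bd hj'
  have hkj : k' = j ↔ j = k' := eq_comm
  have hkj' : j' = k ↔ k = j' := eq_comm
  rw [ugen_eq hj hk, ugen_eq hj' hk', ugen_eq hj hk', ugen_eq hj' hk]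
  unfold sbr
  simp only [smul_mul_smul_comm, sub_mul, mul_sub, smul_mul_assoc, mul_smul_comm,
    matE_mul _ _ _ _ _ _ b1 b2, matE_mul _ _ _ _ _ _ c1 c2,
    matE_mul _ _ _ _ _ _ b1' b2', matE_mul _ _ _ _ _ _ c1' c2',
    posP_inj hk hj', posP_inj hk' hj, posQ_inj hj hk', posQ_inj hj' hk,
    posPQ hk hk', posPQ hk' hk, (posPQ hj hj').symm, (posPQ hj' hj).symm,
    if_false, smul_zero, sub_zero, zero_sub, hkj, hkj']
  have hp : ∀ i, par m i = 0 ∨ par m i = 1 := by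
    intro i; unfold par; split_ifs <;> simp
  unfold sgnU
  by_cases h : k = j' <;> by_cases h' : j = k'
  · subst h h'
    rcases hp j with e | e <;> rcases hp k with f | f <;> simp [e, f] <;> module
  · subst h
    rcases hp j with e | e <;> rcases hp k with f | f <;> rcases hp k' with g | g <;>
      simp [e, f, g, h'] <;> module
  · subst h'
    rcases hp j with e | e <;> rcases hp k with f | f <;> rcases hp j' with g | g <;>
      simp [e, f, g, h] <;> module
  · simp [h, h']

theorem ugen_mem {m n j k : ℕ} (hj : j ∈ Finset.Icc 1 (m+n)) (hk : k ∈ Finset.Icc 1 (m+n)) :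
    ugen m n j k ∈ Submodule.span ℂ
          (Set.range fun q : Fin (m+n) × Fin (m+n) =>
            ugen m n (q.1.val + 1) (q.2.val + 1)) := by
  apply Submodule.subset_span
  simp only [Finset.mem_Icc] at hj hk
  refine ⟨(⟨j-1, by omega⟩, ⟨k-1, by omega⟩), ?_⟩
  have h1 : j - 1 + 1 = j := by omega
  have h2 : k - 1 + 1 = k := by omega
  simp only [h1, h2]

/-- the `(m+n)²` matrices `u_{jk}`, `1 ≤ j,k ≤ m+n`, are linearly
independent over ℂ, and their span is closed under the super bracket (taken
with parities `⟨j⟩+⟨k⟩ mod 2` and `⟨j'⟩+⟨k'⟩ mod 2`). -/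
theorem u_mn_subalgebra (m n : ℕ) (hm : 0 < m) (hn : 0 < n) :
    LinearIndependent ℂ
      (fun q : Fin (m+n) × Fin (m+n) => ugen m n (q.1.val + 1) (q.2.val + 1)) ∧
    (∀ j k j' k' : ℕ, j ∈ Finset.Icc 1 (m+n) → k ∈ Finset.Icc 1 (m+n) →
      j' ∈ Finset.Icc 1 (m+n) → k' ∈ Finset.Icc 1 (m+n) →
      sbr m n ((par m j + par m k) % 2) ((par m j' + par m k') % 2)
          (ugen m n j k) (ugen m n j' k')
        ∈ Submodule.span ℂ
          (Set.range fun q : Fin (m+n) × Fin (m+n) =>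
            ugen m n (q.1.val + 1) (q.2.val + 1))) := by
  refine ⟨?_, ?_⟩
  · rw [Fintype.linearIndependent_iff]
    intro g hg q
    have hF : ∀ i : Fin (m+n), i.val + 1 ∈ Finset.Icc 1 (m+n) := by
      intro i; simp only [Finset.mem_Icc]; omega
    obtain ⟨a1, a2, -⟩ := posP_bd (hF q.1)
    obtain ⟨b1, b2, -⟩ := posP_bd (hF q.2)
    have h := congrFun (congrFun hg ⟨posP m (q.1.val+1) - 1, by omega⟩)
      ⟨posP m (q.2.val+1) - 1, by omega⟩
    have h1 : posP m (q.1.val+1) - 1 + 1 = posP m (q.1.val+1) := by omega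
    have h2 : posP m (q.2.val+1) - 1 + 1 = posP m (q.2.val+1) := by omega
    rw [Matrix.sum_apply, Finset.sum_eq_single q] at h
    · rw [ugen_eq (hF _) (hF _)] at h
      simpa [matE, h1, h2, posPQ (hF q.1) (hF q.2)] using h
    · intro r _ hr
      rw [ugen_eq (hF _) (hF _)]
      have hne : ¬ (q.1.val + 1 = r.1.val + 1 ∧ q.2.val + 1 = r.2.val + 1) := by
        rintro ⟨x, y⟩
        apply hr
        ext <;> omega
      simp only [Matrix.smul_apply, Matrix.sub_apply, matE, Matrix.of_apply, h1, h2,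
        posPQ (hF q.1) (hF r.2), posP_inj (hF q.1) (hF r.1), posP_inj (hF q.2) (hF r.2),
        hne, false_and, if_false]
      simp
    · simp
  · intro j k j' k' hj hk hj' hk'
    rw [sbr_ugen hj hk hj' hk']
    exact Submodule.sub_mem _ (Submodule.smul_mem _ _ (ugen_mem hj hk'))
      (Submodule.smul_mem _ _ (ugen_mem hj' hk))

end
end

section
/- The complex linear span P of the set of matrices consisting of c_j^− for 1 ≤ j ≤ m+n, the brackets ⟦c_j^+, c_k^−⟧ for 1 ≤ j, k ≤ m+n, and the brackets ⟦c_j^−, c_k^−⟧ for 1 ≤ j, k ≤ m+n (each bracket being a commutator unless both indices exceed m, in which case an anticommutator) is closed under the super bracket: for any two spanning elements A, B of the listed form, with A carrying parity equal to the sum mod 2 of the parities ⟨·⟩ of its constituent generators and likewise for B, the matrix ⟦A, B⟧ lies in P. (P is the parabolic subalgebra of osp(2m+1|2n) used in the induced module construction.) -/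
/- Setup: the generators `c_j^±` of osp(2m+1|2n) realized as matrices, and the
parabolic subalgebra P spanned by `c_j^-`, `⟦c_j^+, c_k^-⟧`, `⟦c_j^-, c_k^-⟧`. -/

noncomputable section

/-- The generating elements of the parabolic subalgebra, each paired with its
parity: `c_j^-` with parity `⟨j⟩`, and `⟦c_j^+, c_k^-⟧`, `⟦c_j^-, c_k^-⟧` with
parity `⟨j⟩+⟨k⟩ mod 2`. -/
def pGens (m n : ℕ) : Set (Matrix (Fin (2*m+2*n+1)) (Fin (2*m+2*n+1)) ℂ × ℕ) :=
  {P | ∃ j : ℕ, j ∈ Finset.Icc 1 (m+n) ∧ P = (cgen m n j (-1), par m j)}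
  ∪ {P | ∃ j k : ℕ, j ∈ Finset.Icc 1 (m+n) ∧ k ∈ Finset.Icc 1 (m+n) ∧
      P = (sbr m n (par m j) (par m k) (cgen m n j 1) (cgen m n k (-1)),
           (par m j + par m k) % 2)}
  ∪ {P | ∃ j k : ℕ, j ∈ Finset.Icc 1 (m+n) ∧ k ∈ Finset.Icc 1 (m+n) ∧
      P = (sbr m n (par m j) (par m k) (cgen m n j (-1)) (cgen m n k (-1)),
           (par m j + par m k) % 2)}

/-- Column index attached to `c_j^s`. -/
def pIdx (m n : ℕ) (j : ℕ) (s : ℤ) : ℕ :=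
  if j ≤ m then (if s = 1 then j + m else j)
  else (if s = 1 then 2*m+1+n+(j-m) else 2*m+1+(j-m))

/-- Coefficient of the row part of `c_j^s`. -/
def xCo (m : ℕ) (j : ℕ) (s : ℤ) : ℂ :=
  if j ≤ m then (if s = 1 then -1 else 1) else 1

/-- Coefficient of the column part of `c_j^s`. -/
def yCo (s : ℤ) : ℂ := if s = 1 then 1 else -1

theorem cgen_eq (m n j : ℕ) (s : ℤ) (hs : s = 1 ∨ s = -1) :
    cgen m n j s = (Real.sqrt 2 : ℂ) • (xCo m j s • matE m n (2*m+1) (pIdx m n j s)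
      + yCo s • matE m n (pIdx m n j (-s)) (2*m+1)) := by
  rcases hs with rfl | rfl <;> by_cases h : j ≤ m <;>
    simp [cgen, xCo, yCo, pIdx, h, smul_sub] <;> abel

theorem matE_mul_s4 (m n i j k l : ℕ) (hj : 1 ≤ j) (hj' : j ≤ 2*m+2*n+1) :
    matE m n i j * matE m n k l = if j = k then matE m n i l else 0 := by
  ext a b
  rw [Matrix.mul_apply, Finset.sum_eq_single (⟨j - 1, by omega⟩ : Fin (2*m+2*n+1))]
  · have : j - 1 + 1 = j := by omega
    by_cases h : j = k
    · subst h
      by_cases h1 : a.val + 1 = i <;> by_cases h2 : b.val + 1 = l <;> simp [matE, this, h1, h2]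
    · simp [matE, this, h]
  · intro c _ hc
    have : ¬ (c.val + 1 = j) := fun h => hc (Fin.ext (by simp; omega))
    simp [matE, this]
  · simp

theorem pIdx_range (m n j : ℕ) (s : ℤ) (hj : j ∈ Finset.Icc 1 (m+n)) :
    1 ≤ pIdx m n j s ∧ pIdx m n j s ≤ 2*m+2*n+1 ∧ pIdx m n j s ≠ 2*m+1 := by
  rw [Finset.mem_Icc] at hj
  unfold pIdx
  split_ifs <;> omega

theorem pIdx_inj (m n j k : ℕ) (s t : ℤ) (hj : j ∈ Finset.Icc 1 (m+n))
    (hk : k ∈ Finset.Icc 1 (m+n)) (hs : s = 1 ∨ s = -1) (ht : t = 1 ∨ t = -1) :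
    pIdx m n j s = pIdx m n k t ↔ (j = k ∧ s = t) := by
  rw [Finset.mem_Icc] at hj hk
  unfold pIdx
  split_ifs <;> omega

theorem sqrt_two_sq : (Real.sqrt 2 : ℂ) * (Real.sqrt 2 : ℂ) = 2 := by
  rw [← Complex.ofReal_mul, Real.mul_self_sqrt (by norm_num)]; norm_num

theorem dual_coef (m k : ℕ) (t : ℤ) (ht : t = 1 ∨ t = -1) :
    yCo (-t) * xCo m k t = (-1 : ℂ)^(par m k) * (xCo m k (-t) * yCo t) := by
  rcases ht with rfl | rfl <;> by_cases h : k ≤ m <;> simp [xCo, yCo, par, h]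

/-- The product of two generators. -/
theorem cgen_mul (m n j k : ℕ) (s t : ℤ) (hj : j ∈ Finset.Icc 1 (m+n))
    (hk : k ∈ Finset.Icc 1 (m+n)) (hs : s = 1 ∨ s = -1) (ht : t = 1 ∨ t = -1) :
    cgen m n j s * cgen m n k t =
      (2 * (if j = k ∧ s = -t then xCo m j s * yCo t else 0)) • matE m n (2*m+1) (2*m+1)
      + (2 * (yCo s * xCo m k t)) • matE m n (pIdx m n j (-s)) (pIdx m n k t) := by
  have ht' : -t = 1 ∨ -t = -1 := by omega
  obtain ⟨h1, h2, h3⟩ := pIdx_range m n j s hj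
  obtain ⟨h4, h5, h6⟩ := pIdx_range m n k (-t) hk
  rw [cgen_eq m n j s hs, cgen_eq m n k t ht]
  simp only [smul_mul_smul_comm, sqrt_two_sq, add_mul, mul_add]
  rw [matE_mul_s4 _ _ _ _ _ _ h1 h2, matE_mul_s4 _ _ _ _ _ _ h1 h2,
    matE_mul_s4 _ _ _ _ _ _ (by omega) (by omega), matE_mul_s4 _ _ _ _ _ _ (by omega) (by omega),
    if_neg h3, if_neg (Ne.symm h6), if_pos rfl]
  simp only [pIdx_inj m n j k s (-t) hj hk hs ht']
  split_ifs <;> simp [smul_smul, add_comm]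

/-- The bracket of two generators. -/
theorem bracket_eq (m n j k : ℕ) (s t : ℤ) (hj : j ∈ Finset.Icc 1 (m+n))
    (hk : k ∈ Finset.Icc 1 (m+n)) (hs : s = 1 ∨ s = -1) (ht : t = 1 ∨ t = -1) :
    sbr m n (par m j) (par m k) (cgen m n j s) (cgen m n k t) =
      (2 * (yCo s * xCo m k t)) • matE m n (pIdx m n j (-s)) (pIdx m n k t)
      - ((-1 : ℂ)^(par m j * par m k) * (2 * (yCo t * xCo m j s))) •
        matE m n (pIdx m n k (-t)) (pIdx m n j s) := by
  unfold sbr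
  rw [cgen_mul m n j k s t hj hk hs ht, cgen_mul m n k j t s hk hj ht hs]
  by_cases h : j = k ∧ s = -t
  · obtain ⟨rfl, rfl⟩ := h
    have h0 := dual_coef m j t ht
    have hp : (-1 : ℂ)^(par m j * par m j) = (-1 : ℂ)^(par m j) := by
      unfold par; split_ifs <;> simp
    simp only [neg_neg, and_self, if_true, hp, mul_comm (xCo m j t) (yCo (-t)), h0]
    have hq : (-1 : ℂ)^(par m j) * (-1 : ℂ)^(par m j) = 1 := by
      unfold par; split_ifs <;> simp
    simp only [smul_add, smul_smul]
    have : (-1 : ℂ)^(par m j) * (2 * ((-1 : ℂ)^(par m j) * (xCo m j (-t) * yCo t)))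
      = 2 * (xCo m j (-t) * yCo t) := by linear_combination (2 * (xCo m j (-t) * yCo t)) * hq
    rw [this]
    abel
  · have h' : ¬ (k = j ∧ t = -s) := fun h' => h (by omega)
    simp [h, h', smul_smul]

/-- Product of a middle matrix unit with a generator. -/
theorem unit_mul_cgen (m n i p l : ℕ) (u : ℤ) (hp : 1 ≤ p) (hp' : p ≤ 2*m+2*n+1)
    (hp0 : p ≠ 2*m+1) (hu : u = 1 ∨ u = -1) :
    matE m n i p * cgen m n l u =
      if p = pIdx m n l (-u) then ((Real.sqrt 2 : ℂ) * yCo u) • matE m n i (2*m+1) else 0 := by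
  rw [cgen_eq m n l u hu]
  simp only [mul_add, mul_smul_comm, matE_mul_s4 m n i p _ _ hp hp', if_neg hp0]
  split_ifs <;> simp [smul_smul]

theorem cgen_mul_unit (m n q p l : ℕ) (u : ℤ) (hl : l ∈ Finset.Icc 1 (m+n))
    (hq0 : q ≠ 2*m+1) (hu : u = 1 ∨ u = -1) :
    cgen m n l u * matE m n q p =
      if pIdx m n l u = q then ((Real.sqrt 2 : ℂ) * xCo m l u) • matE m n (2*m+1) p else 0 := by
  obtain ⟨h1, h2, h3⟩ := pIdx_range m n l u hl
  rw [cgen_eq m n l u hu]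
  simp only [add_mul, smul_mul_assoc, matE_mul_s4 m n _ _ _ _ h1 h2,
    matE_mul_s4 m n _ (2*m+1) _ _ (by omega) (by omega), if_neg (Ne.symm hq0)]
  split_ifs <;> simp [smul_smul]

/-- The triple relation (with unspecified coefficients). -/
theorem triple (m n j k l : ℕ) (s t u : ℤ) (hj : j ∈ Finset.Icc 1 (m+n))
    (hk : k ∈ Finset.Icc 1 (m+n)) (hl : l ∈ Finset.Icc 1 (m+n))
    (hs : s = 1 ∨ s = -1) (ht : t = 1 ∨ t = -1) (hu : u = 1 ∨ u = -1) :
    ∃ α β : ℂ, (α = 0 ∨ (j = l ∧ s = -u)) ∧ (β = 0 ∨ (k = l ∧ t = -u)) ∧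
      sbr m n ((par m j + par m k) % 2) (par m l)
        (sbr m n (par m j) (par m k) (cgen m n j s) (cgen m n k t)) (cgen m n l u)
      = α • cgen m n k t + β • cgen m n j s := by
  refine ⟨if j = l ∧ s = -u then
      -((-1 : ℂ)^(par m j * par m k) * (2 * (yCo u * xCo m j s))) else 0,
    if k = l ∧ t = -u then 2 * (yCo u * xCo m k t) else 0, ?_, ?_, ?_⟩
  · split_ifs with h
    · exact Or.inr h
    · exact Or.inl rfl
  · split_ifs with h
    · exact Or.inr h
    · exact Or.inl rfl
  have hs' : -s = 1 ∨ -s = -1 := by omega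
  have ht' : -t = 1 ∨ -t = -1 := by omega
  have hu' : -u = 1 ∨ -u = -1 := by omega
  obtain ⟨a1, a2, a3⟩ := pIdx_range m n j s hj
  obtain ⟨b1, b2, b3⟩ := pIdx_range m n j (-s) hj
  obtain ⟨c1, c2, c3⟩ := pIdx_range m n k t hk
  obtain ⟨d1, d2, d3⟩ := pIdx_range m n k (-t) hk
  rw [bracket_eq m n j k s t hj hk hs ht]
  rw [sbr, sub_mul, mul_sub]
  simp only [smul_mul_assoc, mul_smul_comm]
  rw [unit_mul_cgen m n _ _ l u c1 c2 c3 hu, unit_mul_cgen m n _ _ l u a1 a2 a3 hu,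
    cgen_mul_unit m n _ _ l u hl b3 hu, cgen_mul_unit m n _ _ l u hl d3 hu]
  simp only [
    pIdx_inj m n k l t (-u) hk hl ht hu', pIdx_inj m n j l s (-u) hj hl hs hu',
    pIdx_inj m n l j u (-s) hl hj hu hs', pIdx_inj m n l k u (-t) hl hk hu ht',
    cgen_eq m n j s hs, cgen_eq m n k t ht]
  have e1 : (l = j ∧ u = -s) ↔ (j = l ∧ s = -u) := by omega
  have e2 : (l = k ∧ u = -t) ↔ (k = l ∧ t = -u) := by omega
  simp only [e1, e2]
  have key1 : (j = l ∧ s = -u) → (-1 : ℂ)^((par m j + par m k) % 2 * par m l) * (xCo m l u * yCo s)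
      = (-1 : ℂ)^(par m j * par m k) * (yCo u * xCo m j s) := by
    rintro ⟨rfl, rfl⟩
    rcases hu with rfl | rfl <;> by_cases h : j ≤ m <;> by_cases h2 : k ≤ m <;>
      simp [xCo, yCo, par, h, h2]
  have key2 : (k = l ∧ t = -u) → (-1 : ℂ)^((par m j + par m k) % 2 * par m l) *
      (-1 : ℂ)^(par m j * par m k) * (xCo m l u * yCo t) = yCo u * xCo m k t := by
    rintro ⟨rfl, rfl⟩
    rcases hu with rfl | rfl <;> by_cases h : j ≤ m <;> by_cases h2 : k ≤ m <;>
      simp [xCo, yCo, par, h, h2]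
  generalize (-1 : ℂ)^((par m j + par m k) % 2 * par m l) = T at *
  generalize (-1 : ℂ)^(par m j * par m k) = S at *
  by_cases h1 : j = l ∧ s = -u <;> by_cases h2 : k = l ∧ t = -u
  · have k1 := key1 h1
    have k2 := key2 h2
    simp only [if_pos h1, if_pos h2]
    linear_combination (norm := module) ((-2 * (Real.sqrt 2 : ℂ) * xCo m k t) * k1) • matE m n (2*m+1) (pIdx m n k t)
      + ((2 * (Real.sqrt 2 : ℂ) * xCo m j s) * k2) • matE m n (2*m+1) (pIdx m n j s)
  · have k1 := key1 h1
    simp only [if_pos h1, if_neg h2]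
    linear_combination (norm := module) ((-2 * (Real.sqrt 2 : ℂ) * xCo m k t) * k1) • matE m n (2*m+1) (pIdx m n k t)
  · have k2 := key2 h2
    simp only [if_neg h1, if_pos h2]
    linear_combination (norm := module) ((2 * (Real.sqrt 2 : ℂ) * xCo m j s) * k2) • matE m n (2*m+1) (pIdx m n j s)
  · simp [h1, h2]

theorem neg_one_pow_mod_congr {x y : ℕ} (h : x % 2 = y % 2) : (-1 : ℂ)^x = (-1 : ℂ)^y := by
  rw [neg_one_pow_eq_pow_mod_two, h, ← neg_one_pow_eq_pow_mod_two]

theorem sbr_congr (m n a a' b b' : ℕ) (ha : a % 2 = a' % 2) (hb : b % 2 = b' % 2)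
    (A B : Matrix (Fin (2*m+2*n+1)) (Fin (2*m+2*n+1)) ℂ) :
    sbr m n a b A B = sbr m n a' b' A B := by
  unfold sbr
  rw [neg_one_pow_mod_congr (x := a * b) (y := a' * b') (by rw [Nat.mul_mod, ha, hb, ← Nat.mul_mod])]

/-- Super Jacobi identity. -/
theorem sbr_jacobi (m n a b c : ℕ) (A B C : Matrix (Fin (2*m+2*n+1)) (Fin (2*m+2*n+1)) ℂ) :
    sbr m n a ((b + c) % 2) A (sbr m n b c B C) =
      sbr m n (a + b) c (sbr m n a b A B) C
      + ((-1 : ℂ)^(a*b)) • sbr m n b (a + c) B (sbr m n a c A C) := by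
  rw [sbr_congr m n a a ((b + c) % 2) (b + c) rfl (by omega)]
  unfold sbr
  have h : (-1 : ℂ)^(a*b) * (-1 : ℂ)^(a*b) = 1 := by
    rw [← mul_pow]; norm_num
  simp only [mul_add, add_mul, pow_add, mul_sub, sub_mul, smul_sub, smul_mul_assoc,
    mul_smul_comm, smul_smul, mul_assoc, mul_comm b a]
  have h2 : ∀ z : ℂ, (-1 : ℂ)^(a*b) * ((-1 : ℂ)^(a*b) * z) = z := fun z => by
    rw [← mul_assoc, h, one_mul]
  simp only [h2, h, one_smul]
  module

theorem sbr_add_left (m n a b : ℕ) (α β : ℂ)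
    (A A' B : Matrix (Fin (2*m+2*n+1)) (Fin (2*m+2*n+1)) ℂ) :
    sbr m n a b (α • A + β • A') B = α • sbr m n a b A B + β • sbr m n a b A' B := by
  unfold sbr
  simp only [add_mul, mul_add, smul_mul_assoc, mul_smul_comm]
  module

theorem sbr_smul_right (m n a b : ℕ) (α : ℂ)
    (A B : Matrix (Fin (2*m+2*n+1)) (Fin (2*m+2*n+1)) ℂ) :
    sbr m n a b A (α • B) = α • sbr m n a b A B := by
  unfold sbr
  simp only [smul_mul_assoc, mul_smul_comm]
  module

theorem sbr_antisymm (m n a b : ℕ) (A B : Matrix (Fin (2*m+2*n+1)) (Fin (2*m+2*n+1)) ℂ) :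
    sbr m n a b A B = (-(-1 : ℂ)^(a*b)) • sbr m n b a B A := by
  unfold sbr
  have h : (-1 : ℂ)^(a*b) * (-1 : ℂ)^(a*b) = 1 := by
    rw [← mul_pow]; norm_num
  rw [mul_comm b a, smul_sub, smul_smul, neg_mul, h]
  module

theorem mem_one (m n j : ℕ) (hj : j ∈ Finset.Icc 1 (m+n)) :
    cgen m n j (-1) ∈ Submodule.span ℂ (Prod.fst '' pGens m n) :=
  Submodule.subset_span ⟨_, Or.inl (Or.inl ⟨j, hj, rfl⟩), rfl⟩

theorem mem_two (m n j k : ℕ) (s : ℤ) (hs : s = 1 ∨ s = -1) (hj : j ∈ Finset.Icc 1 (m+n))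
    (hk : k ∈ Finset.Icc 1 (m+n)) :
    sbr m n (par m j) (par m k) (cgen m n j s) (cgen m n k (-1))
      ∈ Submodule.span ℂ (Prod.fst '' pGens m n) := by
  rcases hs with rfl | rfl
  · exact Submodule.subset_span ⟨_, Or.inl (Or.inr ⟨j, k, hj, hk, rfl⟩), rfl⟩
  · exact Submodule.subset_span ⟨_, Or.inr ⟨j, k, hj, hk, rfl⟩, rfl⟩

theorem gens_cases (m n : ℕ) (A : Matrix (Fin (2*m+2*n+1)) (Fin (2*m+2*n+1)) ℂ) (a : ℕ)
    (h : (A, a) ∈ pGens m n) :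
    (∃ j, j ∈ Finset.Icc 1 (m+n) ∧ A = cgen m n j (-1) ∧ a = par m j) ∨
    (∃ (j k : ℕ) (s : ℤ), (s = 1 ∨ s = -1) ∧ j ∈ Finset.Icc 1 (m+n) ∧ k ∈ Finset.Icc 1 (m+n) ∧
      A = sbr m n (par m j) (par m k) (cgen m n j s) (cgen m n k (-1)) ∧
      a = (par m j + par m k) % 2) := by
  rcases h with (⟨j, hj, h⟩ | ⟨j, k, hj, hk, h⟩) | ⟨j, k, hj, hk, h⟩
  · exact Or.inl ⟨j, hj, (Prod.mk.inj h).1, (Prod.mk.inj h).2⟩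
  · exact Or.inr ⟨j, k, 1, Or.inl rfl, hj, hk, (Prod.mk.inj h).1, (Prod.mk.inj h).2⟩
  · exact Or.inr ⟨j, k, -1, Or.inr rfl, hj, hk, (Prod.mk.inj h).1, (Prod.mk.inj h).2⟩

theorem mem_two_one (m n j k l : ℕ) (s : ℤ) (hs : s = 1 ∨ s = -1) (hj : j ∈ Finset.Icc 1 (m+n))
    (hk : k ∈ Finset.Icc 1 (m+n)) (hl : l ∈ Finset.Icc 1 (m+n)) :
    ∃ α : ℂ, (α = 0 ∨ j = l) ∧ sbr m n ((par m j + par m k) % 2) (par m l)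
      (sbr m n (par m j) (par m k) (cgen m n j s) (cgen m n k (-1))) (cgen m n l (-1))
      = α • cgen m n k (-1) := by
  obtain ⟨α, β, hα, hβ, h⟩ := triple m n j k l s (-1) (-1) hj hk hl hs (Or.inr rfl) (Or.inr rfl)
  refine ⟨α, hα.imp_right (·.1), ?_⟩
  have : β = 0 := by
    rcases hβ with h | h
    · exact h
    · exact absurd h.2 (by norm_num)
  rw [h, this, zero_smul, add_zero]

/-- the span P of the listed generators is closed under the super
bracket: for any two generating elements `A`, `B` with their parities `a`, `b`,
the bracket `⟦A,B⟧` lies in P. -/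
theorem parabolic_closed (m n : ℕ) (hm : 0 < m) (hn : 0 < n) :
    ∀ (A B : Matrix (Fin (2*m+2*n+1)) (Fin (2*m+2*n+1)) ℂ) (a b : ℕ),
      (A, a) ∈ pGens m n → (B, b) ∈ pGens m n →
      sbr m n a b A B ∈ Submodule.span ℂ (Prod.fst '' pGens m n) := by
  intro A B a b hA hB
  rcases gens_cases m n A a hA with ⟨j, hj, rfl, rfl⟩ | ⟨j, k, s, hs, hj, hk, rfl, rfl⟩ <;>
  rcases gens_cases m n B b hB with ⟨l, hl, rfl, rfl⟩ | ⟨l, q, u, hu, hl, hq, rfl, rfl⟩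
  · exact mem_two m n j l (-1) (Or.inr rfl) hj hl
  · rw [sbr_antisymm]
    obtain ⟨α, -, h⟩ := mem_two_one m n l q j u hu hl hq hj
    rw [h]
    exact Submodule.smul_mem _ _ (Submodule.smul_mem _ _ (mem_one m n q hq))
  · obtain ⟨α, -, h⟩ := mem_two_one m n j k l s hs hj hk hl
    rw [h]
    exact Submodule.smul_mem _ _ (mem_one m n k hk)
  · rw [sbr_jacobi]
    obtain ⟨α, β, hα, hβ, h⟩ := triple m n j k l s (-1) u hj hk hl hs (Or.inr rfl) hu
    obtain ⟨γ, hγ, h'⟩ := mem_two_one m n j k q s hs hj hk hq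
    rw [h, h', sbr_add_left, sbr_smul_right]
    refine Submodule.add_mem _ (Submodule.add_mem _ ?_ ?_) (Submodule.smul_mem _ _ ?_)
    · rcases hα with rfl | ⟨rfl, -⟩
      · simp
      · rw [sbr_congr m n _ (par m k) _ (par m q) (by omega) rfl]
        exact Submodule.smul_mem _ _ (mem_two m n k q (-1) (Or.inr rfl) hk hq)
    · rcases hβ with rfl | ⟨rfl, -⟩
      · simp
      · rw [sbr_congr m n _ (par m j) _ (par m q) (by omega) rfl]
        exact Submodule.smul_mem _ _ (mem_two m n j q s hs hj hq)
    · rcases hγ with rfl | rfl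
      · simp
      · rw [sbr_congr m n (par m l) (par m l) _ (par m k) rfl (by omega)]
        exact Submodule.smul_mem _ _ (mem_two m n l k u hu hl hk)

end
end

section
/- The matrices b_j^± := c_{m+j}^± for j = 1,…,n satisfy the paraboson triple relations: for all j, k, l ∈ {1,…,n} and all ξ, η, ε ∈ {+1,−1}, [{b_j^ξ, b_k^η}, b_l^ε] = (ε−ξ) δ_{jl} b_k^η + (ε−η) δ_{kl} b_j^ξ, where {·,·} denotes the matrix anticommutator, [·,·] the matrix commutator, and ξ, η, ε are interpreted as the integers ±1 in the expressions (ε−ξ) and (ε−η). -/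
/- Setup: the paraboson generators `b_j^± = c_{m+j}^±` (j = 1,…,n) of
osp(2m+1|2n) realized as matrices. -/

noncomputable section

/-- The paraboson generators `b_j^s` (1-based `j ∈ {1,…,n}`, sign `s ∈ {1,-1}`):
`b_j^+ = √2(e_{2m+1,2m+1+n+j} + e_{2m+1+j,2m+1})`,
`b_j^- = √2(e_{2m+1,2m+1+j} - e_{2m+1+n+j,2m+1})`. -/
def bgen (m n : ℕ) (j : ℕ) (s : ℤ) : Matrix (Fin (2*m+2*n+1)) (Fin (2*m+2*n+1)) ℂ :=
  if s = 1 then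
    (Real.sqrt 2 : ℂ) • (matE m n (2*m+1) (2*m+1+n+j) + matE m n (2*m+1+j) (2*m+1))
  else
    (Real.sqrt 2 : ℂ) • (matE m n (2*m+1) (2*m+1+j) - matE m n (2*m+1+n+j) (2*m+1))

/-- Product of two matrix units. -/
theorem matE_mul_same (m n i j l : ℕ) (h1 : 1 ≤ j) (h2 : j ≤ 2*m+2*n+1) :
    matE m n i j * matE m n j l = matE m n i l := by
  ext a b
  rw [Matrix.mul_apply, Finset.sum_eq_single (⟨j - 1, by omega⟩ : Fin (2*m+2*n+1))]
  · have h : j - 1 + 1 = j := by omega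
    by_cases ha : a.val + 1 = i <;> by_cases hb : b.val + 1 = l <;> simp [matE, h, ha, hb]
  · intro c _ hc
    have h : ¬ (c.val + 1 = j) := by
      intro h
      apply hc
      ext
      simp only
      omega
    simp [matE, h]
  · simp

theorem matE_mul_ne (m n i j k l : ℕ) (h : j ≠ k) :
    matE m n i j * matE m n k l = 0 := by
  ext a b
  rw [Matrix.mul_apply]
  apply Finset.sum_eq_zero
  intro c _
  by_cases hc : c.val + 1 = j
  · have h' : ¬ (c.val + 1 = k) := by omega
    simp [matE, h']
  · simp [matE, hc]

/-- Pulling the scalars out of the triple commutator. -/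
theorem triple_scale {ι : Type*} [Fintype ι] (s : ℂ) (hs : s * s = 2)
    (X Y Z : Matrix ι ι ℂ) (p q : ℂ)
    (h : (2:ℂ) • ((X * Y + Y * X) * Z - Z * (X * Y + Y * X)) = p • Y + q • X) :
    ((s • X) * (s • Y) + (s • Y) * (s • X)) * (s • Z)
      - (s • Z) * ((s • X) * (s • Y) + (s • Y) * (s • X)) = p • (s • Y) + q • (s • X) := by
  have e : p • (s • Y) + q • (s • X) = s • (p • Y + q • X) := by
    rw [smul_add, smul_comm p, smul_comm q]
  rw [e, ← h, ← hs]
  simp only [Matrix.smul_mul, Matrix.mul_smul, smul_smul, ← smul_add]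
  rw [← mul_assoc, smul_sub]

/-- the paraboson triple relations
`[{b_j^ξ, b_k^η}, b_l^ε] = (ε-ξ) δ_{jl} b_k^η + (ε-η) δ_{kl} b_j^ξ`. -/
theorem paraboson_triple_relations (m n : ℕ) (hm : 0 < m) (hn : 0 < n)
    (j k l : ℕ) (hj : j ∈ Finset.Icc 1 n) (hk : k ∈ Finset.Icc 1 n)
    (hl : l ∈ Finset.Icc 1 n)
    (ξ η ε : ℤ) (hξ : ξ = 1 ∨ ξ = -1) (hη : η = 1 ∨ η = -1) (hε : ε = 1 ∨ ε = -1) :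
    (bgen m n j ξ * bgen m n k η + bgen m n k η * bgen m n j ξ) * bgen m n l ε
      - bgen m n l ε * (bgen m n j ξ * bgen m n k η + bgen m n k η * bgen m n j ξ)
    = ((((ε - ξ : ℤ) : ℂ)) * (if j = l then 1 else 0)) • bgen m n k η
      + ((((ε - η : ℤ) : ℂ)) * (if k = l then 1 else 0)) • bgen m n j ξ := by
  rw [Finset.mem_Icc] at hj hk hl
  obtain ⟨hj1, hj2⟩ := hj
  obtain ⟨hk1, hk2⟩ := hk
  obtain ⟨hl1, hl2⟩ := hl
  have hs : (Real.sqrt 2 : ℂ) * (Real.sqrt 2 : ℂ) = 2 := by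
    rw [← Complex.ofReal_mul, Real.mul_self_sqrt (by norm_num)]
    norm_num
  have hneg : ¬ ((-1 : ℤ) = 1) := by norm_num
  rcases hξ with rfl | rfl <;> rcases hη with rfl | rfl <;> rcases hε with rfl | rfl <;>
    simp only [bgen, if_true, if_neg hneg] <;> apply triple_scale _ hs <;>
    by_cases hjl : j = l <;> by_cases hkl : k = l <;> by_cases hjk : j = k <;>
    first
    | (exfalso; omega)
    | (simp (disch := omega) only [mul_add, add_mul, mul_sub, sub_mul, matE_mul_same,
         matE_mul_ne, if_true, if_false, mul_zero, zero_mul, hjl, hkl, hjk]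
       push_cast
       module)

end
end
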